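/- Let α > 0, let ν be a Borel probability measure on ℝ₊, let T, L > 1, and let ε, l, p, κ, γ, M, N be as in the good-path properties. Then there exists Γ > 0, depending only on γ, p and M, such that for every r > 0, every processor-sharing path satisfying the level-(ε, l, κ, γ, M) properties (for r, T, L), and every integer 0 ≤ m ≤ ⌊rT⌋ with ⟨χ, μ̄^{r,m}(0)⟩ > γ/2, one has: inf_{t∈[0,L]} ⟨1, μ̄^{r,m}(t)⟩ ≥ 1/Γ, and sup_{t∈[0,L−h]} S̄^{r,m}_{t,t+h} ≤ hΓ for every 0 < h < L. -/

import Mathlib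

open MeasureTheory Filter Set
noncomputable section
namespace PSQ

/-- ⟨g, ζ⟩ = ∫ g dζ -/
def pair (g : ℝ → ℝ) (ζ : Measure ℝ) : ℝ := ∫ x, g x ∂ζ

/-- total mass ⟨1, ζ⟩ of a finite measure, as a real number -/
def mass (ζ : Measure ℝ) : ℝ := (ζ Set.univ).toReal

/-- truncated Dirac measure δ⁺ₓ -/
def dplus (x : ℝ) : Measure ℝ := if 0 < x then Measure.dirac x else 0

/-- positive part x⁺ -/
def pos (x : ℝ) : ℝ := max x 0

/-- the arrival counting process E(t) = sup{i : U i ≤ t} -/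
def Ecount (U : ℕ → ℝ) (t : ℝ) : ℕ := sSup {i : ℕ | U i ≤ t}

/-- the standing hypotheses on the data of a pathwise processor sharing queue:
nondecreasing arrival times with `U 0 = 0`, `U 1 > 0`, `U i → ∞`, and strictly positive
service times and initial service times. -/
def QueueHyps (U v : ℕ → ℝ) (Z0 : ℕ) (vt : ℕ → ℝ) : Prop :=
  U 0 = 0 ∧ Monotone U ∧ 0 < U 1 ∧ Tendsto U atTop atTop ∧
    (∀ i, 1 ≤ i → 0 < v i) ∧ (∀ j, 1 ≤ j → 0 < vt j)

/-- the defining equations of the state descriptor μ and the cumulative service per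
job S:  `S t = ∫_0^t φ(⟨1, μ(s)⟩) ds` (recall `(0:ℝ)⁻¹ = 0` in Lean, matching φ(0)=0)
and `μ(t) = Σ_j δ⁺_{(ṽ_j - S(t))⁺} + Σ_{i ≤ E(t)} δ⁺_{(v_i - S(t) + S(U_i))⁺}`. -/
def StateEqns (U v : ℕ → ℝ) (Z0 : ℕ) (vt : ℕ → ℝ)
    (μ : ℝ → Measure ℝ) (S : ℝ → ℝ) : Prop :=
  ∀ t, 0 ≤ t →
    (S t = ∫ s in (0:ℝ)..t, (mass (μ s))⁻¹) ∧
    μ t = (∑ j ∈ Finset.range Z0, dplus (pos (vt (j+1) - S t)))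
        + ∑ i ∈ Finset.range (Ecount U t), dplus (pos (v (i+1) - S t + S (U (i+1))))

/-- fluid scaled state descriptor μ̄^r(t) = r⁻¹ μ(rt) -/
def fmu (μ : ℝ → Measure ℝ) (r t : ℝ) : Measure ℝ := ENNReal.ofReal (1/r) • μ (r*t)

/-- fluid scaled arrival process Ē^r(t) = r⁻¹ E(rt) -/
def fE (U : ℕ → ℝ) (r t : ℝ) : ℝ := (Ecount U (r*t) : ℝ) / r

/-- fluid scaled cumulative service S̄^r_{t,t'} = S(r t') - S(r t) -/
def fS (S : ℝ → ℝ) (r t t' : ℝ) : ℝ := S (r*t') - S (r*t)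

end PSQ
end

namespace PSQ

/-- The constraints tying together the constants of the good-path properties:
`ε ∈ (0,1)`, `l, p, κ, γ > 0`, `M > 1`, `l < ε/(32α)`, `κ < l/(2M)`,
`γ < (κε/4) ∧ (l/4)`. -/
def GoodConsts (α ε l p κ γ M : ℝ) : Prop :=
  ε ∈ Set.Ioo (0:ℝ) 1 ∧ 0 < l ∧ 0 < p ∧ 0 < κ ∧ 0 < γ ∧ 1 < M ∧
    l < ε/(32*α) ∧ κ < l/(2*M) ∧ γ < min (κ*ε/4) (l/4)

/-- A processor sharing path satisfies the level-(ε, l, κ, γ, M) good-path properties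
(for r, T, L), with `N = ⌈64M²/(κε²)⌉ + 1`. -/
def GoodPath (U v : ℕ → ℝ) (μ : ℝ → Measure ℝ) (ν : Measure ℝ)
    (T L r ε l p κ γ M : ℝ) : Prop :=
  ∀ m : ℕ, m ≤ ⌊r * T⌋₊ →
    (∀ t ∈ Set.Icc (0:ℝ) L, fE U r ((m:ℝ) + t + l) - fE U r ((m:ℝ) + t) ≤ ε/16) ∧
    (∀ t ∈ Set.Icc (0:ℝ) L,
      max (max (mass (fmu μ r ((m:ℝ)+t))) (pair id (fmu μ r ((m:ℝ)+t))))
        (pair (fun x => x ^ ((1:ℝ)+p)) (fmu μ r ((m:ℝ)+t))) ≤ M) ∧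
    (∀ x : ℝ, 0 ≤ x → ((fmu μ r 0) (Set.Icc x (x+κ))).toReal ≤ ε/4) ∧
    (∀ t ∈ Set.Icc (0:ℝ) L,
      |pair id (fmu μ r ((m:ℝ)+t)) - pair id (fmu μ r (m:ℝ))| ≤ γ/4) ∧
    (∀ t ∈ Set.Icc (0:ℝ) L, ∀ k : ℕ, k ≤ ⌈64*M^2/(κ*ε^2)⌉₊ + 1 →
      (1/r) * (∑ i ∈ Finset.Ioc (Ecount U (r*((m:ℝ)+t))) (Ecount U (r*((m:ℝ)+t+l))),
          if (k:ℝ)*κ ≤ v i ∧ v i < ((k:ℝ)+1)*κ then (1:ℝ) else 0)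
        ≤ (ε/8) * (ν (Set.Ico (((k:ℝ)-1/2)*κ) (((k:ℝ)+3/2)*κ))).toReal)

end PSQ

namespace PSQ

lemma integrable_dplus (y : ℝ) (g : ℝ → ℝ) : Integrable g (dplus y) := by
  unfold dplus
  split_ifs
  · exact integrable_dirac (by simp)
  · exact integrable_zero_measure

lemma ae_nonneg_dplus (y : ℝ) : ∀ᵐ x ∂(dplus y), 0 ≤ x := by
  unfold dplus
  split_ifs with h
  · rw [ae_dirac_eq]
    exact h.le
  · simp

lemma StateEqns.integrable {U v : ℕ → ℝ} {Z0 : ℕ} {vt : ℕ → ℝ} {μ : ℝ → Measure ℝ}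
    {S : ℝ → ℝ} (h : StateEqns U v Z0 vt μ S) {t : ℝ} (ht : 0 ≤ t) (g : ℝ → ℝ) :
    Integrable g (μ t) := by
  rw [(h t ht).2]
  exact (integrable_finsetSum_measure.2 fun _ _ => integrable_dplus _ g).add_measure
    (integrable_finsetSum_measure.2 fun _ _ => integrable_dplus _ g)

lemma StateEqns.ae_nonneg {U v : ℕ → ℝ} {Z0 : ℕ} {vt : ℕ → ℝ} {μ : ℝ → Measure ℝ}
    {S : ℝ → ℝ} (h : StateEqns U v Z0 vt μ S) {t : ℝ} (ht : 0 ≤ t) :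
    ∀ᵐ x ∂(μ t), 0 ≤ x := by
  have hsum : ∀ (n : ℕ) (y : ℕ → ℝ),
      (∑ i ∈ Finset.range n, dplus (y i)) {x | ¬ 0 ≤ x} = 0 := fun n y => by
    rw [Measure.finsetSum_apply]
    exact Finset.sum_eq_zero fun i _ => ae_iff.1 (ae_nonneg_dplus (y i))
  rw [(h t ht).2, ae_iff, Measure.add_apply, hsum, hsum, add_zero]

lemma le_add_rpow_div_rpow {p K x : ℝ} (hp : 0 < p) (hK : 0 < K) (hx : 0 ≤ x) :
    x ≤ K + x ^ (1 + p) / K ^ p := by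
  have hKp : 0 < K ^ p := Real.rpow_pos_of_pos hK p
  rcases le_total x K with hxK | hxK
  · have : 0 ≤ x ^ (1 + p) / K ^ p := by positivity
    linarith
  · have hx0 : 0 < x := hK.trans_le hxK
    have h1 : x ≤ x ^ (1 + p) / K ^ p := by
      rw [le_div_iff₀ hKp, Real.rpow_add hx0, Real.rpow_one]
      exact mul_le_mul_of_nonneg_left (Real.rpow_le_rpow hK.le hxK hp.le) hx
    linarith

/-- Truncation bound for the first moment of a measure on `[0, ∞)` by its mass and its moment
of order `1 + p`. -/
lemma pair_id_le_mass_add {p K : ℝ} (hp : 0 < p) (hK : 0 < K) {ζ : Measure ℝ}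
    (hint : ∀ g : ℝ → ℝ, Integrable g ζ) (hnn : ∀ᵐ x ∂ζ, 0 ≤ x) :
    pair id ζ ≤ K * mass ζ + pair (fun x => x ^ (1 + p)) ζ / K ^ p := by
  have h : ∫ x, id x ∂ζ ≤ ∫ x, (K + x ^ (1 + p) / K ^ p) ∂ζ := by
    refine integral_mono_ae (hint _) (hint _) ?_
    filter_upwards [hnn] with x hx using le_add_rpow_div_rpow hp hK hx
  rw [integral_add (hint _) (hint _), integral_div, integral_const] at h
  simpa [pair, mass, Measure.real, mul_comm] using h

lemma mass_fmu (μ : ℝ → Measure ℝ) {r : ℝ} (hr : 0 < r) (t : ℝ) :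
    mass (fmu μ r t) = mass (μ (r * t)) / r := by
  have : 0 ≤ r⁻¹ := by positivity
  simp [mass, fmu, ENNReal.toReal_ofReal this, div_eq_inv_mul]

lemma StateEqns.nonneg {U v : ℕ → ℝ} {Z0 : ℕ} {vt : ℕ → ℝ} {μ : ℝ → Measure ℝ}
    {S : ℝ → ℝ} (h : StateEqns U v Z0 vt μ S) {t : ℝ} (ht : 0 ≤ t) : 0 ≤ S t := by
  rw [(h t ht).1]
  exact intervalIntegral.integral_nonneg ht fun s _ => inv_nonneg.2 ENNReal.toReal_nonneg

/-- If the rate is not integrable on `[0, b]` then `S b` takes the default value `0`, and the bound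
still holds because `S` is nonnegative. -/
lemma StateEqns.sub_le {U v : ℕ → ℝ} {Z0 : ℕ} {vt : ℕ → ℝ} {μ : ℝ → Measure ℝ}
    {S : ℝ → ℝ} (h : StateEqns U v Z0 vt μ S) {a b c : ℝ} (ha : 0 ≤ a) (hab : a ≤ b)
    (hc : 0 ≤ c) (hbound : ∀ s ∈ Set.Icc a b, (mass (μ s))⁻¹ ≤ c) :
    S b - S a ≤ (b - a) * c := by
  by_cases hi : IntervalIntegrable (fun s => (mass (μ s))⁻¹) volume 0 b
  · have hia : IntervalIntegrable (fun s => (mass (μ s))⁻¹) volume 0 a :=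
      hi.mono_set (by
        rw [uIcc_of_le ha, uIcc_of_le (ha.trans hab)]
        exact Icc_subset_Icc_right hab)
    rw [(h b (ha.trans hab)).1, (h a ha).1,
      intervalIntegral.integral_interval_sub_left hi hia]
    calc ∫ s in a..b, (mass (μ s))⁻¹ ≤ ∫ _ in a..b, c :=
          intervalIntegral.integral_mono_on hab (hia.symm.trans hi) (by simp) hbound
      _ = (b - a) * c := by simp
  · have hSb : S b = 0 := by
      rw [(h b (ha.trans hab)).1, intervalIntegral.integral_undef hi]
    have hSa := h.nonneg ha
    have : 0 ≤ (b - a) * c := mul_nonneg (sub_nonneg.2 hab) hc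
    linarith

end PSQ

open PSQ MeasureTheory in
/-- Lemma 3.12: lower bound on the queue length and upper bound on the
cumulative service rate when the initial shifted workload is above the threshold γ/2.
The constant Γ depends only on γ, p and M (in particular not on ε, l, κ, r or the path). -/
theorem stmt_9 (α : ℝ) (hα : 0 < α) (ν : Measure ℝ) (hν : IsProbabilityMeasure ν)
    (hνsupp : ν (Set.Iio 0) = 0)
    (T L : ℝ) (hT : 1 < T) (hL : 1 < L)
    (p γ M : ℝ) (hp : 0 < p) (hγ : 0 < γ) (hM : 1 < M) :
    ∃ Γ : ℝ, 0 < Γ ∧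
      ∀ ε l κ : ℝ, GoodConsts α ε l p κ γ M →
      ∀ r : ℝ, 0 < r →
      ∀ (U v : ℕ → ℝ) (Z0 : ℕ) (vt : ℕ → ℝ), QueueHyps U v Z0 vt →
      ∀ (μ : ℝ → Measure ℝ) (S : ℝ → ℝ), StateEqns U v Z0 vt μ S →
      GoodPath U v μ ν T L r ε l p κ γ M →
      ∀ m : ℕ, m ≤ ⌊r*T⌋₊ → γ/2 < pair id (fmu μ r (m:ℝ)) →
        (∀ t ∈ Set.Icc (0:ℝ) L, 1/Γ ≤ mass (fmu μ r ((m:ℝ)+t))) ∧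
        (∀ h : ℝ, 0 < h → h < L →
          ∀ t ∈ Set.Icc (0:ℝ) (L-h), fS S r ((m:ℝ)+t) ((m:ℝ)+t+h) ≤ h*Γ) := by
  have hM0 : 0 < M := one_pos.trans hM
  set K : ℝ := (8 * M / γ) ^ (1 / p) with hKdef
  have hK : 0 < K := by positivity
  have hKp : K ^ p = 8 * M / γ := by
    rw [hKdef, ← Real.rpow_mul (by positivity), one_div_mul_cancel hp.ne', Real.rpow_one]
  have hΓ : 0 < 8 * K / γ := by positivity
  refine ⟨8 * K / γ, hΓ, ?_⟩
  intro ε l κ _ r hr U v Z0 vt _ μ S hS hG m hm hw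
  obtain ⟨-, hmom, -, hwork, -⟩ := hG m hm
  have hmass : ∀ t ∈ Set.Icc (0:ℝ) L, 1 / (8 * K / γ) ≤ mass (fmu μ r ((m:ℝ) + t)) := by
    intro t ht
    have ht0 : 0 ≤ r * ((m:ℝ) + t) := mul_nonneg hr.le (add_nonneg m.cast_nonneg ht.1)
    have hle := pair_id_le_mass_add (ζ := fmu μ r ((m:ℝ) + t)) hp hK
      (fun g => (hS.integrable ht0 g).smul_measure ENNReal.ofReal_ne_top)
      (Measure.ae_smul_measure (hS.ae_nonneg ht0) _)
    have hpM := (le_max_right _ _).trans (hmom t ht)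
    have hdiv : pair (fun x => x ^ ((1:ℝ) + p)) (fmu μ r ((m:ℝ) + t)) / K ^ p ≤ γ / 8 := by
      rw [hKp, div_le_iff₀ (by positivity)]
      calc _ ≤ M := hpM
        _ = γ / 8 * (8 * M / γ) := by field_simp
    have hlow := (abs_le.1 (hwork t ht)).1
    have hKm : γ / 8 ≤ K * mass (fmu μ r ((m:ℝ) + t)) := by linarith
    rw [one_div_div, div_le_iff₀ (by positivity)]
    linarith
  refine ⟨hmass, fun h hh _ t ht => ?_⟩
  have ha : 0 ≤ r * ((m:ℝ) + t) := mul_nonneg hr.le (add_nonneg m.cast_nonneg ht.1)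
  have hab : r * ((m:ℝ) + t) ≤ r * ((m:ℝ) + t + h) :=
    mul_le_mul_of_nonneg_left (by linarith) hr.le
  have hc : 0 ≤ 8 * K / γ / r := by positivity
  refine (hS.sub_le ha hab hc fun s hs => ?_).trans (le_of_eq ?_)
  · have hlo : (m:ℝ) + t ≤ s / r := by
      rw [le_div_iff₀ hr, mul_comm]
      exact hs.1
    have hhi : s / r ≤ (m:ℝ) + t + h := by
      rw [div_le_iff₀ hr, mul_comm]
      exact hs.2
    have hms := hmass (s / r - m) ⟨by linarith [ht.1], by linarith [ht.2]⟩
    rw [mass_fmu μ hr, add_sub_cancel, mul_div_cancel₀ s hr.ne', le_div_iff₀ hr] at hms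
    calc (mass (μ s))⁻¹ ≤ (1 / (8 * K / γ) * r)⁻¹ := inv_anti₀ (by positivity) hms
      _ = 8 * K / γ / r := by field_simp
  · field_simp
    ring
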